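/- arXiv:2210.02835 — 2 statements merged into one kernel-verified Lean document; each statement's English description precedes it below -/
import Mathlib

section
/- Let G be a finite simple graph, f : V(G) → {1, 2} a coloring, and ⟨v₁, …, v_n⟩ a Hamiltonian path of G (a walk containing every vertex of G exactly once) such that f(v_i) ≠ f(v_{i+1}) for all 1 ≤ i ≤ n−1 and f(v₁) ≠ f(v_n). Then the walk ⟨v₁, …, v_n⟩ transforms f into the coloring f′ given by f′(v) = 3 − f(v) for every vertex v; that is, every vertex's color is flipped. -/
/-- Swap the colors of vertices `a` and `b`. -/
def swapC {V C : Type*} [DecidableEq V] (f : V → C) (a b : V) : V → C :=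
  fun v => if v = a then f b else if v = b then f a else f v

/-- The coloring obtained from `f` by sequentially swapping the colors of
consecutive vertices along the list (walk) of vertices. -/
def transformList {V C : Type*} [DecidableEq V] : List V → (V → C) → (V → C)
  | [], f => f
  | [_], f => f
  | a :: b :: rest, f => transformList (b :: rest) (swapC f a b)

theorem transformList_of_notMem {V C : Type*} [DecidableEq V] {v : V} :
    ∀ (l : List V) (g : V → C), v ∉ l → transformList l g v = g v
  | [], _, _ => rfl
  | [_], _, _ => rfl
  | a :: b :: t, g, h => by
    simp only [List.mem_cons, not_or] at h
    rw [transformList, transformList_of_notMem (b :: t) _ (by simp [h.2.1, h.2.2])]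
    simp [swapC, h.1, h.2.1]

/-- Walking along `a :: t`, where `g` agrees with the alternating coloring `f` on `t` and gives `a`
the color opposite to that of the last vertex, flips the `f`-color of every vertex of `a :: t`. -/
theorem transformList_cons_eq_three_sub {V : Type*} [DecidableEq V] {f : V → ℕ}
    (hrange : ∀ v, f v = 1 ∨ f v = 2) (t : List V) (a : V) (g : V → ℕ)
    (hg : ∀ v ∈ t, g v = f v) (hnd : (a :: t).Nodup)
    (halt : (a :: t).IsChain (fun a b => f a ≠ f b))
    (ha : g a = 3 - f ((a :: t).getLast (List.cons_ne_nil a t))) {v : V} (hv : v ∈ a :: t) :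
    transformList (a :: t) g v = 3 - f v := by
  induction t generalizing a g with
  | nil =>
    obtain rfl : v = a := by simpa using hv
    simpa [transformList] using ha
  | cons b t ih =>
    rw [List.nodup_cons] at hnd
    rw [List.isChain_cons_cons] at halt
    obtain ⟨hab, hat⟩ : a ≠ b ∧ a ∉ t := by simpa using hnd.1
    rw [transformList]
    rcases List.mem_cons.1 hv with rfl | hv
    · rw [transformList_of_notMem _ _ hnd.1]
      have hb := hg b List.mem_cons_self
      have h₁ := hrange v
      have h₂ := hrange b
      have h₃ := halt.1
      simp only [swapC, if_true]
      omega
    · refine ih b _ (fun w hw => ?_) hnd.2 halt.2 ?_ hv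
      · have hwa : w ≠ a := fun h => hat (h ▸ hw)
        have hwb : w ≠ b := fun h => (List.nodup_cons.1 hnd.2).1 (h ▸ hw)
        simpa [swapC, hwa, hwb] using hg w (List.mem_cons_of_mem _ hw)
      · simpa [swapC, hab.symm] using ha

/-- if `f : V → {1,2}` and `⟨v₁, …, v_n⟩` is a Hamiltonian path of
`G` with `f(v_i) ≠ f(v_{i+1})` for consecutive vertices and `f(v₁) ≠ f(v_n)`,
then walking along the path transforms `f` into `v ↦ 3 - f v`,
i.e. flips every vertex's color. -/
theorem ham_path_flips_colors {V : Type*} [Fintype V] [DecidableEq V]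
    (G : SimpleGraph V) (f : V → ℕ) (hrange : ∀ v, f v = 1 ∨ f v = 2)
    (l : List V) (hl : l.Chain' G.Adj) (hnd : l.Nodup) (hall : ∀ v, v ∈ l)
    (hne : l ≠ [])
    (halt : l.Chain' (fun a b => f a ≠ f b))
    (hends : f (l.head hne) ≠ f (l.getLast hne)) :
    transformList l f = fun v => 3 - f v := by
  funext v
  cases l with
  | nil => exact absurd rfl hne
  | cons a t =>
    refine transformList_cons_eq_three_sub hrange t a f (fun _ _ => rfl) hnd halt ?_ (hall v)
    have h₁ := hrange a
    have h₂ := hrange ((a :: t).getLast hne)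
    rw [List.head_cons] at hends
    omega
end

section
/- Under the stated complete-graph setup, every walk W in K from s to t such that every vertex of P occurs in W and W transforms f into f′ has length at least |R| + cc − 2. -/
/-- The vertices that a walk from `s` to `t` transforming `f` into `f'` and visiting `P` must
visit. -/
def requiredVertices {V C : Type*} [Fintype V] [DecidableEq V] [DecidableEq C]
    (f f' : V → C) (s t : V) (P : Finset V) : Finset V :=
  Finset.univ.filter (fun v => f v ≠ f' v) ∪ {s, t} ∪ P

open scoped Classical in
/-- The number of classes met by `S` in the quotient by the relation generated by `r`. -/
noncomputable def quotCard {C : Type*} (r : C → C → Prop) (S : Finset C) : ℕ :=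
  (S.image (Quot.mk r)).card

theorem quotCard_mono {C : Type*} (r : C → C → Prop) {S T : Finset C} (h : S ⊆ T) :
    quotCard r S ≤ quotCard r T := by
  classical
  exact Finset.card_le_card (Finset.image_subset_image h)

theorem card_image_le_quotCard {C D : Type*} [DecidableEq D] {r : C → C → Prop} (g : C → D)
    (hg : ∀ a b, r a b → g a = g b) (S : Finset C) : (S.image g).card ≤ quotCard r S := by
  classical
  have : S.image g = (S.image (Quot.mk r)).image (Quot.lift g hg) := by
    rw [Finset.image_image]
    rfl
  rw [this]
  exact Finset.card_image_le

theorem ncard_classes_le_quotCard {C : Type*} (r : C → C → Prop) (S : Finset C) :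
    Set.ncard {T : Set C | ∃ c ∈ S, T = {d | d ∈ S ∧ Relation.EqvGen r c d}} ≤ quotCard r S := by
  classical
  have hsub : {T : Set C | ∃ c ∈ S, T = {d | d ∈ S ∧ Relation.EqvGen r c d}} ⊆
      (fun x : Quot r => {d | d ∈ S ∧ x = Quot.mk r d}) ''
        ((S.image (Quot.mk r) : Finset (Quot r)) : Set (Quot r)) := by
    rintro T ⟨c, hc, rfl⟩
    refine ⟨Quot.mk r c, by simpa using ⟨c, hc, rfl⟩, ?_⟩
    ext d
    simp [Quot.eq]
  calc _ ≤ _ := Set.ncard_le_ncard hsub ((Finset.finite_toSet _).image _)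
    _ ≤ _ := Set.ncard_image_le (Finset.finite_toSet _)
    _ = _ := Set.ncard_coe_finset _

section Swap

variable {V C : Type*} [DecidableEq V] (f f' : V → C) (a b : V)

theorem swapC_left : swapC f a b a = f b := by simp [swapC]

theorem swapC_right : swapC f a b b = f a := by
  by_cases h : b = a <;> simp [swapC, h]

theorem swapC_of_ne {v : V} (ha : v ≠ a) (hb : v ≠ b) : swapC f a b v = f v := by
  simp [swapC, ha, hb]

/-- Swapping two colors lowers the number of classes by at most one. -/
theorem quotCard_le_swapC_add_one (S : Finset C) :
    quotCard (fun c d => ∃ v, f v = c ∧ f' v = d) S ≤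
      quotCard (fun c d => ∃ v, swapC f a b v = c ∧ f' v = d) S + 1 := by
  classical
  set r : C → C → Prop := fun c d => ∃ v, f v = c ∧ f' v = d
  let m : Quot r → Quot r := fun x => if x = Quot.mk r (f b) then Quot.mk r (f a) else x
  have hr (v : V) : Quot.mk r (f v) = Quot.mk r (f' v) := Quot.sound ⟨v, rfl, rfl⟩
  have hab : m (Quot.mk r (f a)) = m (Quot.mk r (f b)) := by simp [m]
  have hm : ∀ c d, (∃ v, swapC f a b v = c ∧ f' v = d) →
      m (Quot.mk r c) = m (Quot.mk r d) := by
    rintro _ _ ⟨v, rfl, rfl⟩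
    rw [← hr v]
    by_cases ha : v = a
    · rw [ha, swapC_left, hab]
    by_cases hb : v = b
    · rw [hb, swapC_right, hab]
    rw [swapC_of_ne f a b ha hb]
  have hsub : S.image (Quot.mk r) ⊆
      insert (Quot.mk r (f b)) (S.image fun c => m (Quot.mk r c)) := by
    intro x hx
    obtain ⟨c, hc, rfl⟩ := Finset.mem_image.1 hx
    by_cases h : Quot.mk r c = Quot.mk r (f b)
    · simp [h]
    · exact Finset.mem_insert_of_mem (Finset.mem_image.2 ⟨c, hc, by simp [m, h]⟩)
  calc quotCard r S ≤ _ := Finset.card_le_card hsub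
    _ ≤ _ := Finset.card_insert_le _ _
    _ ≤ _ := Nat.add_le_add_right
      (card_image_le_quotCard (fun c => m (Quot.mk r c)) hm S) 1

variable [Fintype V] [DecidableEq C]

/-- Swapping along an edge of the walk lowers the number of required vertices plus the number of
color classes by at most one. -/
theorem requiredVertices_card_add_quotCard_le_swapC (t : V) (P : Finset V) :
    (requiredVertices f f' a t P).card +
        quotCard (fun c d => ∃ v, f v = c ∧ f' v = d) ((requiredVertices f f' a t P).image f) ≤
      (requiredVertices (swapC f a b) f' b t (P.erase a)).card +
        quotCard (fun c d => ∃ v, swapC f a b v = c ∧ f' v = d)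
          ((requiredVertices (swapC f a b) f' b t (P.erase a)).image (swapC f a b)) + 1 := by
  classical
  set R := requiredVertices f f' a t P
  set R₁ := requiredVertices (swapC f a b) f' b t (P.erase a) with hR₁
  have hb : b ∈ R₁ := by simp [hR₁, requiredVertices]
  have hR : R ⊆ insert a R₁ := by
    intro v hv
    rw [Finset.mem_insert]
    by_cases hva : v = a
    · exact Or.inl hva
    by_cases hvb : v = b
    · exact Or.inr (hvb ▸ hb)
    right
    simp only [R, requiredVertices, Finset.mem_union, Finset.mem_filter, Finset.mem_insert,
      Finset.mem_singleton, Finset.mem_univ, true_and] at hv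
    simp only [hR₁, requiredVertices, Finset.mem_union, Finset.mem_filter, Finset.mem_insert,
      Finset.mem_singleton, Finset.mem_univ, true_and, Finset.mem_erase, swapC_of_ne f a b hva hvb]
    tauto
  by_cases ha : a ∈ R₁
  · rw [Finset.insert_eq_self.2 ha] at hR
    have himage : R.image f ⊆ R₁.image (swapC f a b) := by
      intro c hc
      obtain ⟨v, hv, rfl⟩ := Finset.mem_image.1 hc
      by_cases hva : v = a
      · exact Finset.mem_image.2 ⟨b, hb, by rw [swapC_right, hva]⟩
      by_cases hvb : v = b
      · exact Finset.mem_image.2 ⟨a, ha, by rw [swapC_left, hvb]⟩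
      exact Finset.mem_image.2 ⟨v, hR hv, swapC_of_ne f a b hva hvb⟩
    have h₁ := Finset.card_le_card hR
    have h₂ := (quotCard_mono (fun c d => ∃ v, f v = c ∧ f' v = d) himage).trans
      (quotCard_le_swapC_add_one f f' a b _)
    omega
  · have hfa : f b = f' a := by
      by_contra h
      exact ha (by simp [hR₁, requiredVertices, swapC_left, h])
    set r : C → C → Prop := fun c d => ∃ v, f v = c ∧ f' v = d
    have hr (v : V) : Quot.mk r (f v) = Quot.mk r (f' v) := Quot.sound ⟨v, rfl, rfl⟩
    have hab : Quot.mk r (f a) = Quot.mk r (f b) := hfa ▸ hr a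
    have hswap (v : V) : Quot.mk r (swapC f a b v) = Quot.mk r (f v) := by
      by_cases hva : v = a
      · rw [hva, swapC_left, hab]
      by_cases hvb : v = b
      · rw [hvb, swapC_right, hab]
      rw [swapC_of_ne f a b hva hvb]
    have himage : (R.image f).image (Quot.mk r) ⊆
        (R₁.image (swapC f a b)).image (Quot.mk r) := by
      simp only [Finset.image_image]
      intro c hc
      obtain ⟨v, hv, rfl⟩ := Finset.mem_image.1 hc
      rcases Finset.mem_insert.1 (hR hv) with rfl | hv
      · exact Finset.mem_image.2 ⟨b, hb, (hswap b).trans hab.symm⟩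
      · exact Finset.mem_image.2 ⟨v, hv, hswap v⟩
    have h₁ := (Finset.card_le_card hR).trans (Finset.card_insert_le _ _)
    have h₂ : quotCard r (R.image f) ≤ _ := (Finset.card_le_card himage).trans
      (card_image_le_quotCard (r := fun c d => ∃ v, swapC f a b v = c ∧ f' v = d) (Quot.mk r)
        (by rintro _ _ ⟨v, rfl, rfl⟩; exact (hswap v).trans (hr v)) _)
    omega

end Swap

/-- The lower bound holds for an arbitrary list of vertices and without any assumption on the
colorings. -/
theorem requiredVertices_card_add_quotCard_le_length {V C : Type*} [Fintype V] [DecidableEq V]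
    [DecidableEq C] (f' : V → C) (t : V) (l : List V) (f : V → C) (s : V) (P : Finset V)
    (hs : l.head? = some s) (ht : l.getLast? = some t) (hP : ∀ v ∈ P, v ∈ l)
    (hf : transformList l f = f') :
    (requiredVertices f f' s t P).card +
        quotCard (fun c d => ∃ v, f v = c ∧ f' v = d) ((requiredVertices f f' s t P).image f) ≤
      l.length + 1 := by
  induction l generalizing f s P with
  | nil => simp at hs
  | cons a l ih =>
    obtain rfl : a = s := by simpa using hs
    cases l with
    | nil =>
      obtain rfl : a = t := by simpa using ht
      obtain rfl : f = f' := hf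
      have hR : requiredVertices f f a a P = {a} := by
        ext v
        simp only [requiredVertices, Finset.mem_union, Finset.mem_filter, Finset.mem_insert,
          Finset.mem_singleton]
        have := hP v
        simp only [List.mem_singleton] at this
        tauto
      simp [hR, quotCard]
    | cons b l =>
      have h := ih (swapC f a b) b (P.erase a) rfl (by simpa using ht)
        (fun v hv => List.mem_of_ne_of_mem (Finset.ne_of_mem_erase hv)
          (hP v (Finset.mem_of_mem_erase hv))) hf
      have := requiredVertices_card_add_quotCard_le_swapC f f' a b t P
      simp only [List.length_cons] at h ⊢
      omega

/-- lower bound on complete graphs: under the complete-graph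
setup, every walk `W` from `s` to `t` in the complete graph `K` visiting all
of `P` that transforms `f` into `f′` has length at least `|R| + cc - 2`. -/
theorem complete_lower_bound {V C : Type*} [Fintype V] [DecidableEq V]
    [DecidableEq C] (f f' : V → C) (s t : V) (P : Finset V) (z : C)
    (hbal : ∀ c : C, (Finset.univ.filter (fun v => f v = c)).card
      = (Finset.univ.filter (fun v => f' v = c)).card)
    (hfs : f s = z) (hft : f' t = z)
    (hfz : ∀ v, v ≠ s → f v ≠ z) (hf'z : ∀ v, v ≠ t → f' v ≠ z) :
    let R : Finset V := Finset.univ.filter (fun v => f v ≠ f' v) ∪ {s, t} ∪ P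
    let S : Finset C := R.image f
    let r : C → C → Prop := fun a b => ∃ v ∈ R, f v = a ∧ f' v = b
    let cc : ℕ := Set.ncard
      {T : Set C | ∃ c ∈ S, T = {d | d ∈ S ∧ Relation.EqvGen r c d}}
    ∀ l : List V, l.Chain' (⊤ : SimpleGraph V).Adj → l.head? = some s →
      l.getLast? = some t → (∀ v ∈ P, v ∈ l) → transformList l f = f' →
      R.card + cc - 2 ≤ l.length - 1 := by
  intro R S r cc l _ hs ht hP hf
  have hlen := requiredVertices_card_add_quotCard_le_length f' t l f s P hs ht hP hf
  have hcc : cc ≤ quotCard (fun c d => ∃ v, f v = c ∧ f' v = d) S := by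
    classical
    refine (ncard_classes_le_quotCard r S).trans (card_image_le_quotCard (Quot.mk r) ?_ S)
    rintro _ _ ⟨v, rfl, rfl⟩
    by_cases h : f v = f' v
    · rw [h]
    · exact Quot.sound ⟨v, by simp [R, h], rfl, rfl⟩
  change R.card + quotCard _ S ≤ l.length + 1 at hlen
  omega
end
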